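/- arXiv:1411.2703 — 2 statements merged into one kernel-verified Lean document; each statement's English description precedes it below -/
import Mathlib

section
/- Let I ⊆ ℝ be an open interval, U : I → ℂ smooth, M ≥ 1, and let φ₁, …, φ_M, ψ : I → ℂ be smooth functions satisfying −φⱼ''(x) + U(x)φⱼ(x) = Ẽⱼ·φⱼ(x) (j = 1,…,M) and −ψ''(x) + U(x)ψ(x) = E·ψ(x) for all x ∈ I, with E, Ẽ₁,…,Ẽ_M ∈ ℂ. Assume the Wronskian W(x) := W[φ₁,…,φ_M](x) satisfies W(x) ≠ 0 for all x ∈ I. Define ψ⁽ᴹ⁾(x) := W[φ₁,…,φ_M,ψ](x)/W(x) and U⁽ᴹ⁾(x) := U(x) − 2(W''(x)/W(x) − (W'(x)/W(x))²). Then −(ψ⁽ᴹ⁾)''(x) + U⁽ᴹ⁾(x)ψ⁽ᴹ⁾(x) = E·ψ⁽ᴹ⁾(x) for all x ∈ I. -/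
/-- The Wronskian of `n` functions: determinant of the matrix whose `(j,k)` entry is the
`j`-th derivative (0-based) of the `k`-th function. -/
noncomputable def wronskian (n : ℕ) (f : Fin n → ℝ → ℂ) (x : ℝ) : ℂ :=
  (Matrix.of fun j k : Fin n => iteratedDeriv (j : ℕ) (f k) x).det

open scoped ContDiff

section SmoothOn

variable {s : Set ℝ} {f g : ℝ → ℂ} {x : ℝ}

lemma ContDiffOn.iteratedDeriv_of_isOpen (hf : ContDiffOn ℝ ∞ f s) (hs : IsOpen s) (k : ℕ) :
    ContDiffOn ℝ ∞ (iteratedDeriv k f) s := by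
  induction k with
  | zero => simpa using hf
  | succ k ih =>
    rw [iteratedDeriv_succ]
    exact ((contDiffOn_infty_iff_deriv_of_isOpen hs).1 ih).2

lemma ContDiffOn.hasDerivAt_of_isOpen (hf : ContDiffOn ℝ ∞ f s) (hs : IsOpen s) (hx : x ∈ s) :
    HasDerivAt f (deriv f x) x :=
  ((hf.contDiffAt (hs.mem_nhds hx)).differentiableAt (by simp)).hasDerivAt

lemma ContDiffOn.hasDerivAt_iteratedDeriv (hf : ContDiffOn ℝ ∞ f s) (hs : IsOpen s)
    (hx : x ∈ s) (k : ℕ) : HasDerivAt (iteratedDeriv k f) (iteratedDeriv (k + 1) f x) x := by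
  rw [iteratedDeriv_succ]
  exact (hf.iteratedDeriv_of_isOpen hs k).hasDerivAt_of_isOpen hs hx

lemma ContDiffOn.contDiffAt_nat (hf : ContDiffOn ℝ ∞ f s) (hs : IsOpen s) (hx : x ∈ s) (k : ℕ) :
    ContDiffAt ℝ k f x :=
  (hf.contDiffAt (hs.mem_nhds hx)).of_le (by exact_mod_cast le_top)

lemma deriv_eqOn_of_isOpen (h : Set.EqOn f g s) (hs : IsOpen s) :
    Set.EqOn (deriv f) (deriv g) s := fun _ hx =>
  (Filter.eventuallyEq_of_mem (hs.mem_nhds hx) h).deriv_eq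

end SmoothOn

/-- The linear differential operator `∑_{k < n} aₖ Dᵏ`. -/
noncomputable def diffOp (n : ℕ) (a : ℕ → ℝ → ℂ) (f : ℝ → ℂ) (x : ℝ) : ℂ :=
  ∑ k ∈ Finset.range n, a k x * iteratedDeriv k f x

section DiffOp

variable {s : Set ℝ} {a : ℕ → ℝ → ℂ} {f g U : ℝ → ℂ} {x : ℝ}

lemma diffOp_congr (hs : IsOpen s) (h : Set.EqOn f g s) (hx : x ∈ s) (n : ℕ) :
    diffOp n a f x = diffOp n a g x :=
  Finset.sum_congr rfl fun k _ => by
    rw [(Filter.eventuallyEq_of_mem (hs.mem_nhds hx) h).iteratedDeriv_eq k]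

lemma iteratedDeriv_sub_sum (hs : IsOpen s) {ι : Type*} [Fintype ι] {h : ι → ℝ → ℂ}
    (hf : ContDiffOn ℝ ∞ f s) (hh : ∀ j, ContDiffOn ℝ ∞ (h j) s) (c : ι → ℂ) (hx : x ∈ s)
    (k : ℕ) :
    iteratedDeriv k (fun y => f y - ∑ j, c j * h j y) x
      = iteratedDeriv k f x - ∑ j, c j * iteratedDeriv k (h j) x := by
  have hc : ∀ j, ContDiffAt ℝ k (fun y => c j * h j y) x := fun j =>
    contDiffAt_const.mul ((hh j).contDiffAt_nat hs hx k)
  rw [iteratedDeriv_fun_sub (hf.contDiffAt_nat hs hx k) (ContDiffAt.sum fun j _ => hc j),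
    iteratedDeriv_fun_sum fun j _ => hc j]
  simp

lemma diffOp_sub_sum (hs : IsOpen s) {ι : Type*} [Fintype ι] {h : ι → ℝ → ℂ}
    (hf : ContDiffOn ℝ ∞ f s) (hh : ∀ j, ContDiffOn ℝ ∞ (h j) s) (c : ι → ℂ) (hx : x ∈ s)
    (n : ℕ) :
    diffOp n a (fun y => f y - ∑ j, c j * h j y) x
      = diffOp n a f x - ∑ j, c j * diffOp n a (h j) x := by
  simp only [diffOp, iteratedDeriv_sub_sum hs hf hh c hx, mul_sub, Finset.sum_sub_distrib,
    Finset.mul_sum]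
  rw [Finset.sum_comm]
  simp only [mul_left_comm]

lemma diffOp_const_mul (c : ℂ) (n : ℕ) :
    diffOp n a (fun y => c * f y) x = c * diffOp n a f x := by
  simp [diffOp, Finset.mul_sum, mul_left_comm]

lemma hasDerivAt_diffOp (hs : IsOpen s) (ha : ∀ k, ContDiffOn ℝ ∞ (a k) s)
    (hf : ContDiffOn ℝ ∞ f s) (hx : x ∈ s) (n : ℕ) :
    HasDerivAt (diffOp n a f)
      (diffOp n (fun k => deriv (a k)) f x + diffOp n a (deriv f) x) x := by
  simp only [diffOp, ← Finset.sum_add_distrib, ← iteratedDeriv_succ']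
  exact HasDerivAt.fun_sum fun k _ =>
    ((ha k).hasDerivAt_of_isOpen hs hx).mul (hf.hasDerivAt_iteratedDeriv hs hx k)

lemma deriv_deriv_diffOp (hs : IsOpen s) (ha : ∀ k, ContDiffOn ℝ ∞ (a k) s)
    (hf : ContDiffOn ℝ ∞ f s) (hx : x ∈ s) (n : ℕ) :
    deriv (deriv (diffOp n a f)) x
      = diffOp n (fun k => deriv (deriv (a k))) f x
        + 2 * diffOp n (fun k => deriv (a k)) (deriv f) x + diffOp n a (deriv (deriv f)) x := by
  have ha' : ∀ k, ContDiffOn ℝ ∞ (deriv (a k)) s := fun k =>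
    (ha k).deriv_of_isOpen hs le_rfl
  have hf' : ContDiffOn ℝ ∞ (deriv f) s := hf.deriv_of_isOpen hs le_rfl
  have h : Set.EqOn (deriv (diffOp n a f))
      (fun y => diffOp n (fun k => deriv (a k)) f y + diffOp n a (deriv f) y) s :=
    fun y hy => (hasDerivAt_diffOp hs ha hf hy n).deriv
  rw [deriv_eqOn_of_isOpen h hs hx,
    ((hasDerivAt_diffOp hs ha' hf hx n).fun_add (hasDerivAt_diffOp hs ha hf' hx n)).deriv]
  ring

lemma iteratedDeriv_mul_of_vanishing (hs : IsOpen s) (hU : ContDiffOn ℝ ∞ U s)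
    (hf : ContDiffOn ℝ ∞ f s) (hx : x ∈ s) {n k : ℕ} (hk : k ≤ n)
    (h0 : ∀ i < n, iteratedDeriv i f x = 0) :
    iteratedDeriv k (fun y => U y * f y) x = U x * iteratedDeriv k f x := by
  rw [iteratedDeriv_fun_mul (hU.contDiffAt_nat hs hx k) (hf.contDiffAt_nat hs hx k),
    Finset.sum_eq_single 0]
  · simp
  · intro i hi hi0
    rw [h0 (k - i) (by grind), mul_zero]
  · simp

/-- The intertwining relation `(-D² + U + 2aₘ') L = L (-D² + U)` modulo the derivatives of
order at most `m`, for a monic operator `L` of order `m + 1` with subleading coefficient `aₘ`. -/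
lemma intertwining_of_vanishing (hs : IsOpen s) {m : ℕ} (ha : ∀ k, ContDiffOn ℝ ∞ (a k) s)
    (ham : ∀ y ∈ s, a (m + 1) y = 1) (hU : ContDiffOn ℝ ∞ U s) (hf : ContDiffOn ℝ ∞ f s)
    (hx : x ∈ s) (h0 : ∀ i < m + 1, iteratedDeriv i f x = 0) :
    -(deriv (deriv (diffOp (m + 2) a f)) x) + (U x + 2 * deriv (a m) x) * diffOp (m + 2) a f x
      = diffOp (m + 2) a (fun y => -(deriv (deriv f) y) + U y * f y) x := by
  have hf'' : ContDiffOn ℝ ∞ (deriv (deriv f)) s :=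
    (hf.deriv_of_isOpen hs le_rfl).deriv_of_isOpen hs le_rfl
  have hd : Set.EqOn (deriv (a (m + 1))) (fun _ => 0) s := by
    have := deriv_eqOn_of_isOpen (g := fun _ => (1 : ℂ)) ham hs
    simpa using this
  have hdd : deriv (deriv (a (m + 1))) x = 0 := by
    simpa using deriv_eqOn_of_isOpen hd hs hx
  have hL : ∀ b : ℕ → ℝ → ℂ,
      diffOp (m + 2) b f x = b (m + 1) x * iteratedDeriv (m + 1) f x := fun b => by
    rw [diffOp, Finset.sum_range_succ, Finset.sum_eq_zero, zero_add]
    intro i hi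
    rw [h0 i (Finset.mem_range.1 hi), mul_zero]
  have hL' : diffOp (m + 2) (fun k => deriv (a k)) (deriv f) x
      = deriv (a m) x * iteratedDeriv (m + 1) f x := by
    rw [diffOp, Finset.sum_range_succ, Finset.sum_range_succ, Finset.sum_eq_zero, hd hx,
      ← iteratedDeriv_succ']
    · ring
    · intro i hi
      rw [← iteratedDeriv_succ', h0 (i + 1) (by grind), mul_zero]
  have hR : diffOp (m + 2) a (fun y => -(deriv (deriv f) y) + U y * f y) x
      = -diffOp (m + 2) a (deriv (deriv f)) x + U x * diffOp (m + 2) a f x := by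
    rw [diffOp, diffOp, diffOp, ← Finset.sum_neg_distrib, Finset.mul_sum,
      ← Finset.sum_add_distrib]
    refine Finset.sum_congr rfl fun k hk => ?_
    rw [iteratedDeriv_fun_add (hf''.neg.contDiffAt_nat hs hx k)
      ((hU.mul hf).contDiffAt_nat hs hx k), iteratedDeriv_fun_neg,
      iteratedDeriv_mul_of_vanishing hs hU hf hx (by grind : k ≤ m + 1) h0]
    ring
  rw [hR, deriv_deriv_diffOp hs ha hf hx, hL', hL, hL, hdd, ham x hx]
  ring

end DiffOp

section Det

open Matrix

variable {n : Type*} [Fintype n] [DecidableEq n]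

lemma HasDerivAt.matrix_det {A : ℝ → Matrix n n ℂ} {A' : Matrix n n ℂ} {x : ℝ}
    (hA : ∀ i j, HasDerivAt (fun y => A y i j) (A' i j) x) :
    HasDerivAt (fun y => (A y).det) (∑ i, ((A x).updateRow i (A' i)).det) x := by
  have key : HasDerivAt (fun y => ∑ σ : Equiv.Perm n,
      ((Equiv.Perm.sign σ : ℤ) : ℂ) * ∏ i, (A y)ᵀ (σ i) i) _ x :=
    HasDerivAt.fun_sum fun σ _ =>
      (HasDerivAt.fun_finsetProd fun i _ => hA i (σ i)).const_mul _
  simp only [← det_apply', det_transpose] at key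
  refine key.congr_deriv ?_
  simp only [← det_transpose (updateRow _ _ _), det_apply', Finset.mul_sum]
  rw [Finset.sum_comm]
  refine Finset.sum_congr rfl fun i _ => Finset.sum_congr rfl fun σ _ => ?_
  rw [← Finset.mul_prod_erase _ _ (Finset.mem_univ i)]
  simp only [transpose_apply, updateRow_self, smul_eq_mul]
  rw [mul_comm (A' i (σ i))]
  congr 2
  exact Finset.prod_congr rfl fun j hj => by rw [updateRow_ne (Finset.ne_of_mem_erase hj)]

lemma ContDiffOn.matrix_det {A : ℝ → Matrix n n ℂ} {s : Set ℝ}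
    (hA : ∀ i j, ContDiffOn ℝ ∞ (fun y => A y i j) s) :
    ContDiffOn ℝ ∞ (fun y => (A y).det) s := by
  simp only [det_apply']
  exact ContDiffOn.sum fun σ _ => contDiffOn_const.mul (contDiffOn_prod fun i _ => hA _ _)

end Det

/-- The determinant of the derivatives of orders `0, …, n` of `n` functions with the order `k`
left out. -/
noncomputable def wronskianMinor {n : ℕ} (f : Fin n → ℝ → ℂ) (k : ℕ) (x : ℝ) : ℂ :=
  (Matrix.of fun i j : Fin n => iteratedDeriv (if (i : ℕ) < k then i else i + 1) (f j) x).det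

section Wronskian

variable {s : Set ℝ} {n : ℕ} {φ : Fin n → ℝ → ℂ} {x : ℝ}

lemma wronskianMinor_self (φ : Fin n → ℝ → ℂ) : wronskianMinor φ n = wronskian n φ := by
  ext x
  simp [wronskianMinor, wronskian]

lemma contDiffOn_wronskianMinor (hs : IsOpen s) (hφ : ∀ j, ContDiffOn ℝ ∞ (φ j) s) (k : ℕ) :
    ContDiffOn ℝ ∞ (wronskianMinor φ k) s :=
  ContDiffOn.matrix_det fun _ j => (hφ j).iteratedDeriv_of_isOpen hs _

lemma wronskian_snoc (φ : Fin n → ℝ → ℂ) (f : ℝ → ℂ) (x : ℝ) :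
    wronskian (n + 1) (Fin.snoc φ f) x
      = diffOp (n + 1) (fun k y => (-1) ^ (k + n) * wronskianMinor φ k y) f x := by
  rw [wronskian, Matrix.det_succ_column _ (Fin.last n), diffOp, Finset.sum_range]
  refine Finset.sum_congr rfl fun k _ => ?_
  have hm : ((Matrix.of fun i j : Fin (n + 1) =>
      iteratedDeriv (i : ℕ) ((Fin.snoc φ f : Fin (n + 1) → ℝ → ℂ) j) x).submatrix
        k.succAbove (Fin.last n).succAbove).det = wronskianMinor φ k x := by
    rw [wronskianMinor]
    congr 1
    ext i j
    simp only [Matrix.submatrix_apply, Matrix.of_apply, Fin.succAbove_last, Fin.snoc_castSucc]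
    congr 1
    simp only [Fin.succAbove, Fin.lt_def, Fin.val_castSucc]
    split_ifs <;> simp
  rw [hm]
  simp only [Matrix.of_apply, Fin.snoc_last, Fin.val_last]
  ring

lemma wronskian_snoc_self (φ : Fin n → ℝ → ℂ) (j : Fin n) (x : ℝ) :
    wronskian (n + 1) (Fin.snoc φ (φ j)) x = 0 := by
  refine Matrix.det_zero_of_column_eq (i := j.castSucc) (j := Fin.last n)
    (Fin.castSucc_lt_last j).ne fun i => ?_
  simp

lemma deriv_wronskian {m : ℕ} {φ : Fin (m + 1) → ℝ → ℂ} (hs : IsOpen s)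
    (hφ : ∀ j, ContDiffOn ℝ ∞ (φ j) s) (hx : x ∈ s) :
    deriv (wronskian (m + 1) φ) x = wronskianMinor φ m x := by
  have h := HasDerivAt.matrix_det
    (A := fun y => Matrix.of fun i j : Fin (m + 1) => iteratedDeriv (i : ℕ) (φ j) y)
    (A' := Matrix.of fun i j : Fin (m + 1) => iteratedDeriv (i + 1 : ℕ) (φ j) x)
    fun i j => (hφ j).hasDerivAt_iteratedDeriv hs hx i
  refine h.deriv.trans ?_
  rw [Finset.sum_eq_single (Fin.last m)]
  · rw [wronskianMinor]
    congr 1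
    ext i j
    rcases Fin.eq_castSucc_or_eq_last i with ⟨i, rfl⟩ | rfl
    · simp
    · simp
  · intro i _ hi
    obtain ⟨i, rfl⟩ := (Fin.eq_castSucc_or_eq_last i).resolve_right hi
    have hne : i.castSucc ≠ i.succ := (Fin.castSucc_lt_succ).ne
    refine Matrix.det_zero_of_row_eq hne ?_
    rw [Matrix.updateRow_self, Matrix.updateRow_ne hne.symm]
    ext j
    simp
  · simp

lemma exists_vanishing_combination (hs : IsOpen s) (hφ : ∀ j, ContDiffOn ℝ ∞ (φ j) s)
    {f : ℝ → ℂ} (hf : ContDiffOn ℝ ∞ f s) (hx : x ∈ s) (hW : wronskian n φ x ≠ 0) :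
    ∃ c : Fin n → ℂ, ∀ i < n, iteratedDeriv i (fun y => f y - ∑ j, c j * φ j y) x = 0 := by
  have hA := (Matrix.isUnit_iff_isUnit_det _).2 (isUnit_iff_ne_zero.2 hW)
  obtain ⟨c, hc⟩ := (Matrix.mulVec_surjective_iff_isUnit.2 hA)
    fun i : Fin n => iteratedDeriv (i : ℕ) f x
  refine ⟨c, fun i hi => ?_⟩
  rw [iteratedDeriv_sub_sum hs hf hφ c hx, ← congrFun hc ⟨i, hi⟩]
  simp [Matrix.mulVec, dotProduct, mul_comm]

end Wronskian

/-- Darboux's theorem (first part): the `M`-step Darboux transform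
`ψ⁽ᴹ⁾ = W[φ₁,…,φ_M,ψ]/W[φ₁,…,φ_M]` of a solution `ψ` of `-f'' + U f = E f` solves the equation
with the deformed potential `U⁽ᴹ⁾ = U - 2 (W''/W - (W'/W)²)` at the same energy `E`. -/
theorem stmt_1 (a b : ℝ) (M : ℕ) (hM : 1 ≤ M) (U : ℝ → ℂ)
    (φ : Fin M → ℝ → ℂ) (ψ : ℝ → ℂ) (E : ℂ) (F : Fin M → ℂ)
    (hU : ContDiffOn ℝ (⊤ : ℕ∞) U (Set.Ioo a b))
    (hφ : ∀ j, ContDiffOn ℝ (⊤ : ℕ∞) (φ j) (Set.Ioo a b))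
    (hψ : ContDiffOn ℝ (⊤ : ℕ∞) ψ (Set.Ioo a b))
    (heqφ : ∀ j, ∀ x ∈ Set.Ioo a b,
      -(deriv (deriv (φ j)) x) + U x * φ j x = F j * φ j x)
    (heqψ : ∀ x ∈ Set.Ioo a b, -(deriv (deriv ψ) x) + U x * ψ x = E * ψ x)
    (hW : ∀ x ∈ Set.Ioo a b, wronskian M φ x ≠ 0) :
    ∀ x ∈ Set.Ioo a b,
      -(deriv (deriv (fun y => wronskian (M + 1) (Fin.snoc φ ψ) y / wronskian M φ y)) x)
        + (U x - 2 * (deriv (deriv (wronskian M φ)) x / wronskian M φ x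
            - (deriv (wronskian M φ) x / wronskian M φ x) ^ 2))
          * (wronskian (M + 1) (Fin.snoc φ ψ) x / wronskian M φ x)
      = E * (wronskian (M + 1) (Fin.snoc φ ψ) x / wronskian M φ x) := by
  obtain ⟨m, rfl⟩ : ∃ m, M = m + 1 := ⟨M - 1, by omega⟩
  intro x hx
  have hs : IsOpen (Set.Ioo a b) := isOpen_Ioo
  set s := Set.Ioo a b
  set W := wronskian (m + 1) φ
  have hWs : ContDiffOn ℝ ∞ W s := by
    simpa only [W, ← wronskianMinor_self] using contDiffOn_wronskianMinor hs hφ (m + 1)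
  let A : ℕ → ℝ → ℂ := fun k y => (-1) ^ (k + (m + 1)) * wronskianMinor φ k y / W y
  have hA : ∀ k, ContDiffOn ℝ ∞ (A k) s := fun k => by
    simpa only [A, div_eq_mul_inv, Pi.inv_apply] using
      (contDiffOn_const.mul (contDiffOn_wronskianMinor hs hφ k)).mul (hWs.inv hW)
  have hA_lead : ∀ y ∈ s, A (m + 1) y = 1 := fun y hy => by
    simp only [A, wronskianMinor_self, Even.neg_one_pow ⟨m + 1, rfl⟩, one_mul]
    exact div_self (hW y hy)
  have hA_sub : Set.EqOn (A m) (fun y => -(deriv W y / W y)) s := fun y hy => by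
    simp only [A, W, deriv_wronskian hs hφ hy,
      Odd.neg_one_pow (⟨m, by ring⟩ : Odd (m + (m + 1)))]
    ring
  have hA_sub' : deriv (A m) x = -(deriv (deriv W) x / W x - (deriv W x / W x) ^ 2) := by
    have hWx := hW x hx
    rw [deriv_eqOn_of_isOpen hA_sub hs hx,
      (((hWs.deriv_of_isOpen hs le_rfl).hasDerivAt_of_isOpen hs hx).fun_div
        (hWs.hasDerivAt_of_isOpen hs hx) hWx).fun_neg.deriv]
    field_simp
  have hL : ∀ f : ℝ → ℂ, (fun y => wronskian (m + 1 + 1) (Fin.snoc φ f) y / W y)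
      = diffOp (m + 2) A f := fun f => by
    ext y
    simp only [wronskian_snoc, diffOp, Finset.sum_div, A]
    exact Finset.sum_congr rfl fun k _ => by ring
  have hLφ : ∀ j, ∀ y, diffOp (m + 2) A (φ j) y = 0 := fun j y => by
    rw [← hL]
    simp [wronskian_snoc_self]
  obtain ⟨c, hc⟩ := exists_vanishing_combination hs hφ hψ hx (hW x hx)
  set g : ℝ → ℂ := fun y => ψ y - ∑ j, c j * φ j y with hg_def
  have hg : ContDiffOn ℝ ∞ g s :=
    hψ.sub (ContDiffOn.sum fun j _ => contDiffOn_const.mul (hφ j))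
  have hLg : Set.EqOn (diffOp (m + 2) A g) (diffOp (m + 2) A ψ) s := fun y hy => by
    rw [hg_def, diffOp_sub_sum hs hψ hφ c hy]
    simp [hLφ]
  have hHg : Set.EqOn (fun y => -(deriv (deriv g) y) + U y * g y)
      (fun y => E * ψ y - ∑ j, (c j * F j) * φ j y) s := fun y hy => by
    have h2 := iteratedDeriv_sub_sum hs hψ hφ c hy 2
    simp only [iteratedDeriv_succ, iteratedDeriv_zero] at h2
    simp only [hg_def, h2, mul_assoc, ← heqψ y hy, ← heqφ _ y hy, mul_add, mul_sub, mul_neg,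
      Finset.sum_add_distrib, Finset.sum_neg_distrib, Finset.mul_sum, mul_left_comm (U y)]
    ring
  have key := intertwining_of_vanishing hs hA hA_lead hU hg hx hc
  rw [diffOp_congr hs hHg hx, diffOp_sub_sum hs (contDiffOn_const.mul hψ) hφ _ hx,
    diffOp_const_mul, hLg hx, deriv_eqOn_of_isOpen (deriv_eqOn_of_isOpen hLg hs) hs hx,
    hA_sub'] at key
  simp only [hLφ, mul_zero, Finset.sum_const_zero, sub_zero] at key
  have hLx := congrFun (hL ψ) x
  rw [hL, hLx, ← key]
  ring
end

section
/- Let g, h ∈ ℝ, let v be a non-negative integer, and let P : ℝ → ℝ be a polynomial function satisfying the Jacobi differential equation (1 − t²)·P''(t) + ( (1 − g − h) − (g − h + 2)t )·P'(t) + v(v + g − h + 1)·P(t) = 0 for all t ∈ ℝ. Define φ̃(x) := (sin x)^g · (cos x)^{1−h} · P(cos 2x) for x ∈ (0, π/2). Then for all x ∈ (0, π/2): −φ̃''(x) + ( g(g−1)/sin²x + h(h−1)/cos²x − (g+h)² )·φ̃(x) = −4(g + v + 1/2)(h − v − 1/2)·φ̃(x). -/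
/-- Logarithmic derivative of the weight `(sin x)^a (cos x)^b` on `(0, π/2)`. -/
lemma hasDerivAt_sin_rpow_mul_cos_rpow (a b : ℝ) {x : ℝ} (hs : 0 < Real.sin x)
    (hc : 0 < Real.cos x) :
    HasDerivAt (fun y => Real.sin y ^ a * Real.cos y ^ b)
      (Real.sin x ^ a * Real.cos x ^ b
        * (a * Real.cos x / Real.sin x - b * Real.sin x / Real.cos x)) x := by
  refine (((Real.hasDerivAt_sin x).rpow_const (p := a) (Or.inl hs.ne')).mul
    ((Real.hasDerivAt_cos x).rpow_const (p := b) (Or.inl hc.ne'))).congr_deriv ?_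
  rw [Real.rpow_sub_one hs.ne', Real.rpow_sub_one hc.ne']
  field_simp
  ring

lemma hasDerivAt_mul_cos_div_sin_sub (a b : ℝ) {x : ℝ} (hs : Real.sin x ≠ 0)
    (hc : Real.cos x ≠ 0) :
    HasDerivAt (fun y => a * Real.cos y / Real.sin y - b * Real.sin y / Real.cos y)
      (-a / Real.sin x ^ 2 - b / Real.cos x ^ 2) x := by
  refine ((((Real.hasDerivAt_cos x).const_mul a).div (Real.hasDerivAt_sin x) hs).sub
    (((Real.hasDerivAt_sin x).const_mul b).div (Real.hasDerivAt_cos x) hc)).congr_deriv ?_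
  linear_combination
    (-a / Real.sin x ^ 2 - b / Real.cos x ^ 2) * Real.sin_sq_add_cos_sq x

lemma hasDerivAt_eval_cos_two_mul (p : Polynomial ℝ) (x : ℝ) :
    HasDerivAt (fun y => p.eval (Real.cos (2 * y)))
      (p.derivative.eval (Real.cos (2 * x)) * (-(2 * Real.sin (2 * x)))) x := by
  have h2 : HasDerivAt (fun y : ℝ => 2 * y) 2 x := by
    simpa using (hasDerivAt_id x).const_mul (2 : ℝ)
  have h3 : HasDerivAt (fun y => Real.cos (2 * y)) (-(2 * Real.sin (2 * x))) x := by
    convert h2.cos using 1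
    ring
  exact (p.hasDerivAt _).comp x h3

/-- Type I virtual state wavefunction of the Pöschl–Teller potential: if the polynomial `P`
satisfies the Jacobi differential equation
`(1 - t²) P'' + ((1 - g - h) - (g - h + 2) t) P' + v (v + g - h + 1) P = 0`, then
`φ̃(x) = (sin x)^g (cos x)^{1-h} P(cos 2x)` satisfies
`-φ̃'' + (g(g-1)/sin²x + h(h-1)/cos²x - (g+h)²) φ̃ = -4(g + v + 1/2)(h - v - 1/2) φ̃`
on `(0, π/2)`. -/
theorem stmt_19 (g h : ℝ) (v : ℕ) (P : ℝ → ℝ)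
    (hpoly : ∃ p : Polynomial ℝ, P = fun t => p.eval t)
    (hode : ∀ t : ℝ,
      (1 - t ^ 2) * deriv (deriv P) t
        + ((1 - g - h) - (g - h + 2) * t) * deriv P t
        + (v : ℝ) * ((v : ℝ) + g - h + 1) * P t = 0) :
    ∀ x ∈ Set.Ioo (0 : ℝ) (Real.pi / 2),
      -(deriv (deriv (fun y =>
          Real.sin y ^ g * Real.cos y ^ (1 - h) * P (Real.cos (2 * y)))) x)
        + (g * (g - 1) / Real.sin x ^ 2 + h * (h - 1) / Real.cos x ^ 2 - (g + h) ^ 2)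
          * (Real.sin x ^ g * Real.cos x ^ (1 - h) * P (Real.cos (2 * x)))
      = -4 * (g + (v : ℝ) + 1 / 2) * (h - (v : ℝ) - 1 / 2)
          * (Real.sin x ^ g * Real.cos x ^ (1 - h) * P (Real.cos (2 * x))) := by
  obtain ⟨p, rfl⟩ := hpoly
  have hd : deriv (fun t => p.eval t) = fun t => p.derivative.eval t :=
    funext fun t => p.deriv
  have hd2 : deriv (fun t => p.derivative.eval t) = fun t => p.derivative.derivative.eval t :=
    funext fun t => p.derivative.deriv
  simp only [hd, hd2] at hode
  have hpos : ∀ y ∈ Set.Ioo (0 : ℝ) (Real.pi / 2), 0 < Real.sin y ∧ 0 < Real.cos y :=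
    fun y hy => ⟨Real.sin_pos_of_pos_of_lt_pi hy.1 (by linarith [hy.2, Real.pi_pos]),
      Real.cos_pos_of_mem_Ioo ⟨by linarith [hy.1, Real.pi_pos], hy.2⟩⟩
  intro x hx
  obtain ⟨hs, hc⟩ := hpos x hx
  have hfirst := fun y (hy : y ∈ Set.Ioo (0 : ℝ) (Real.pi / 2)) =>
    ((hasDerivAt_sin_rpow_mul_cos_rpow g (1 - h) (hpos y hy).1 (hpos y hy).2).mul
      (hasDerivAt_eval_cos_two_mul p y)).deriv
  have hW := hasDerivAt_sin_rpow_mul_cos_rpow g (1 - h) hs hc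
  have hL := hasDerivAt_mul_cos_div_sin_sub g (1 - h) hs.ne' hc.ne'
  have hsin : HasDerivAt (fun y : ℝ => -(2 * Real.sin (2 * y))) (-(4 * Real.cos (2 * x))) x := by
    have h2 : HasDerivAt (fun y : ℝ => 2 * y) 2 x := by
      simpa using (hasDerivAt_id x).const_mul (2 : ℝ)
    refine (h2.sin.const_mul 2).neg.congr_deriv ?_
    ring
  have hsecond := ((hW.mul hL).mul (hasDerivAt_eval_cos_two_mul p x)).add
    (hW.mul ((hasDerivAt_eval_cos_two_mul p.derivative x).mul hsin))
  have heq := Filter.EventuallyEq.deriv_eq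
    (Filter.eventuallyEq_of_mem (Ioo_mem_nhds hx.1 hx.2) hfirst)
  have hderiv := heq.trans hsecond.deriv
  simp only [Pi.mul_def] at hderiv
  rw [hderiv]
  have hode := hode (Real.cos (2 * x))
  have h1 := Real.sin_sq_add_cos_sq x
  have ht : Real.cos (2 * x) = Real.cos x ^ 2 - Real.sin x ^ 2 := Real.cos_two_mul' x
  have htt := Real.sin_sq_add_cos_sq (2 * x)
  have hLsq : (g * Real.cos x / Real.sin x - (1 - h) * Real.sin x / Real.cos x) ^ 2
      + (-g / Real.sin x ^ 2 - (1 - h) / Real.cos x ^ 2)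
      = g * (g - 1) / Real.sin x ^ 2 + h * (h - 1) / Real.cos x ^ 2 - (g + 1 - h) ^ 2 := by
    have hcot : (Real.cos x / Real.sin x) ^ 2 = 1 / Real.sin x ^ 2 - 1 := by
      field_simp
      linarith
    have htan : (Real.sin x / Real.cos x) ^ 2 = 1 / Real.cos x ^ 2 - 1 := by
      field_simp
      linarith
    have hmul : Real.cos x / Real.sin x * (Real.sin x / Real.cos x) = 1 := by
      field_simp
    linear_combination g ^ 2 * hcot + (1 - h) ^ 2 * htan - 2 * g * (1 - h) * hmul
  have hLs : (g * Real.cos x / Real.sin x - (1 - h) * Real.sin x / Real.cos x)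
      * Real.sin (2 * x) = (g + h - 1) + (g + 1 - h) * Real.cos (2 * x) := by
    rw [Real.sin_two_mul, ht]
    field_simp
    linear_combination (g + h - 1) * h1
  generalize Real.sin x ^ g * Real.cos x ^ (1 - h) = W at *
  generalize g * Real.cos x / Real.sin x - (1 - h) * Real.sin x / Real.cos x = L at *
  linear_combination (-W * p.eval (Real.cos (2 * x))) * hLsq
    + 4 * W * p.derivative.eval (Real.cos (2 * x)) * hLs
    - 4 * W * p.derivative.derivative.eval (Real.cos (2 * x)) * htt
    - 4 * W * hode
end
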